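/- Let d ≥ 1, R ∈ ℕ, let u : ℤ^d → ℝ be harmonic on the ball B_{4R} (i.e. (Δu)(x) = 0 for all x with ‖x‖₁ ≤ 4R − 1), and let 0 ≤ ε ≤ 0.5. Then for every natural number n with 16 < n ≤ R, Q_u(2n) ≤ √( e^{n^{−2ε}} · Q_u(n) · Q_u(4n) ) + 2^{−n^{0.5−ε}} · Q_u(4n), where Q_u(m) = (A^m(u²))(0) and the exponents n^{−2ε}, n^{0.5−ε} are real powers of the real number n. -/

import Mathlib

/-- The standard generators of `ℤ^d`: `±e_i`, indexed by `Fin d × Bool`. -/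
def latticeGen (d : ℕ) (s : Fin d × Bool) : Fin d → ℤ :=
  fun j => if s.1 = j then (if s.2 then 1 else -1) else 0

/-- The averaging operator `(A f)(x) = (1/(2d)) ∑_{s ∈ S} f(x+s)`. -/
noncomputable def latticeAvg (d : ℕ) (f : (Fin d → ℤ) → ℝ) : (Fin d → ℤ) → ℝ :=
  fun x => (1 / (2 * (d : ℝ))) * ∑ s : Fin d × Bool, f (x + latticeGen d s)

/-- The discrete Laplacian `Δf = Af − f`. -/
noncomputable def latticeLap (d : ℕ) (f : (Fin d → ℤ) → ℝ) : (Fin d → ℤ) → ℝ :=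
  fun x => latticeAvg d f x - f x

/-- The growth function `Q_u(n) = (Aⁿ (u²))(0)`. -/
noncomputable def growthQ (d : ℕ) (u : (Fin d → ℤ) → ℝ) (n : ℕ) : ℝ :=
  (latticeAvg d)^[n] (fun y => (u y) ^ 2) 0

/-- Forward difference of a function on `ℕ`. -/
def fdiff (g : ℕ → ℝ) : ℕ → ℝ := fun n => g (n + 1) - g n

/-- The averaging operator as a linear endomorphism. -/
noncomputable def latticeAvgLin (d : ℕ) : Module.End ℝ ((Fin d → ℤ) → ℝ) where
  toFun := latticeAvg d
  map_add' f g := by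
    ext x
    simp [latticeAvg, Finset.sum_add_distrib, mul_add]
  map_smul' c f := by
    ext x
    simp only [latticeAvg, Pi.smul_apply, smul_eq_mul, ← Finset.mul_sum, RingHom.id_apply]
    ring

/-- The Laplacian as a linear endomorphism. -/
noncomputable def latticeLapLin (d : ℕ) : Module.End ℝ ((Fin d → ℤ) → ℝ) :=
  latticeAvgLin d - 1

theorem latticeLapLin_apply (d : ℕ) (f : (Fin d → ℤ) → ℝ) :
    latticeLapLin d f = latticeLap d f := rfl

theorem growthQ_eq_sum (d : ℕ) (u : (Fin d → ℤ) → ℝ) {m N : ℕ} (h : m ≤ N) :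
    growthQ d u m = ∑ k ∈ Finset.range (N + 1),
      (m.choose k : ℝ) * (latticeLapLin d ^ k) (fun y => (u y) ^ 2) 0 := by
  have hA : latticeAvgLin d = latticeLapLin d + 1 := by simp [latticeLapLin]
  have hQ : growthQ d u m = (latticeAvgLin d ^ m) (fun y => (u y) ^ 2) 0 := by
    rw [Module.End.pow_apply]
    rfl
  rw [hQ, hA, (Commute.one_right _).add_pow, LinearMap.sum_apply, Finset.sum_apply]
  have hterm : ∀ k, (latticeLapLin d ^ k * 1 ^ (m - k) * (m.choose k : Module.End ℝ ((Fin d → ℤ) → ℝ)))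
      (fun y => (u y) ^ 2) 0
      = (m.choose k : ℝ) * (latticeLapLin d ^ k) (fun y => (u y) ^ 2) 0 := by
    intro k
    rw [one_pow, mul_one, ← Nat.cast_comm, ← nsmul_eq_mul, LinearMap.smul_apply, Pi.smul_apply,
      nsmul_eq_mul]
  simp only [hterm]
  refine Finset.sum_subset (Finset.range_mono (by omega)) fun k _ hk => ?_
  rw [Nat.choose_eq_zero_of_lt (by simpa using hk)]
  simp

theorem sum_abs_latticeGen (d : ℕ) (s : Fin d × Bool) : ∑ i, |latticeGen d s i| = 1 := by
  rw [Finset.sum_eq_single s.1]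
  · cases hs : s.2 <;> simp [latticeGen, hs]
  · intro j _ hj
    simp [latticeGen, hj.symm]
  · simp

theorem sum_abs_add_latticeGen_le (d : ℕ) (x : Fin d → ℤ) (s : Fin d × Bool) :
    ∑ i, |(x + latticeGen d s) i| ≤ ∑ i, |x i| + 1 := by
  rw [← sum_abs_latticeGen d s, ← Finset.sum_add_distrib]
  exact Finset.sum_le_sum fun i _ => abs_add_le _ _

/-- The `k`-th power of the Laplacian at `0` only sees the values on the ball of radius `k`. -/
theorem latticeLapLin_pow_apply_zero_congr (d k : ℕ) {f g : (Fin d → ℤ) → ℝ}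
    (h : ∀ y, ∑ i, |y i| ≤ (k : ℤ) → f y = g y) :
    (latticeLapLin d ^ k) f 0 = (latticeLapLin d ^ k) g 0 := by
  induction k generalizing f g with
  | zero => exact h 0 (by simp)
  | succ k ih =>
    rw [pow_succ, Module.End.mul_apply, Module.End.mul_apply]
    refine ih fun y hy => ?_
    have hs : ∀ s, f (y + latticeGen d s) = g (y + latticeGen d s) := fun s =>
      h _ ((sum_abs_add_latticeGen_le d y s).trans (by push_cast; linarith))
    simp only [latticeLapLin_apply, latticeLap, latticeAvg, hs]
    rw [h y (by push_cast; linarith)]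

theorem latticeLap_sq (d : ℕ) (hd : 1 ≤ d) {u : (Fin d → ℤ) → ℝ} {y : Fin d → ℤ}
    (h : latticeLap d u y = 0) :
    latticeLap d (fun z => (u z) ^ 2) y =
      (1 / (2 * (d : ℝ))) * ∑ s, (u (y + latticeGen d s) - u y) ^ 2 := by
  have hd' : (d : ℝ) ≠ 0 := by positivity
  have hu : ∑ s, u (y + latticeGen d s) = 2 * d * u y := by
    simp only [latticeLap, latticeAvg] at h
    field_simp at h
    linarith
  simp only [latticeLap, latticeAvg, sub_sq, Finset.sum_add_distrib, Finset.sum_sub_distrib]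
  rw [← Finset.sum_mul, ← Finset.mul_sum, hu]
  simp only [Finset.sum_const, Finset.card_univ, Fintype.card_prod, Fintype.card_fin,
    Fintype.card_bool, nsmul_eq_mul]
  push_cast
  field_simp
  ring

theorem latticeLap_translate_sub (d : ℕ) (u : (Fin d → ℤ) → ℝ) (v y : Fin d → ℤ) :
    latticeLap d (fun z => u (z + v) - u z) y = latticeLap d u (y + v) - latticeLap d u y := by
  simp only [latticeLap, latticeAvg, Finset.sum_sub_distrib, add_right_comm y v]
  ring

theorem latticeLapLin_pow_sq_nonneg (d : ℕ) (hd : 1 ≤ d) (k : ℕ) {u : (Fin d → ℤ) → ℝ}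
    (hu : ∀ y, ∑ i, |y i| < (k : ℤ) → latticeLap d u y = 0) :
    0 ≤ (latticeLapLin d ^ k) (fun y => (u y) ^ 2) 0 := by
  induction k generalizing u with
  | zero => exact sq_nonneg (u 0)
  | succ k ih =>
    rw [pow_succ, Module.End.mul_apply,
      latticeLapLin_pow_apply_zero_congr d k
        (g := (1 / (2 * (d : ℝ))) • ∑ s, fun y => (u (y + latticeGen d s) - u y) ^ 2),
      map_smul, map_sum, Pi.smul_apply, Finset.sum_apply, smul_eq_mul]
    · refine mul_nonneg (by positivity) (Finset.sum_nonneg fun s _ => ih fun y hy => ?_)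
      have hs := sum_abs_add_latticeGen_le d y s
      rw [latticeLap_translate_sub, hu _ (by push_cast; linarith), hu _ (by push_cast; linarith),
        sub_zero]
    · intro y hy
      rw [latticeLapLin_apply, latticeLap_sq d hd (hu y (by push_cast; linarith))]
      simp [Finset.sum_apply]

theorem choose_mul_two_pow_le (m k : ℕ) : m.choose k * 2 ^ k ≤ (2 * m).choose k := by
  induction k with
  | zero => simp
  | succ k ih =>
    refine Nat.le_of_mul_le_mul_right ?_ k.succ_pos
    calc m.choose (k + 1) * 2 ^ (k + 1) * (k + 1)
        = m.choose (k + 1) * (k + 1) * 2 ^ (k + 1) := by ring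
      _ = m.choose k * 2 ^ k * (2 * (m - k)) := by rw [Nat.choose_succ_right_eq]; ring
      _ ≤ (2 * m).choose k * (2 * m - k) := Nat.mul_le_mul ih (by omega)
      _ = (2 * m).choose (k + 1) * (k + 1) := (Nat.choose_succ_right_eq _ _).symm

theorem choose_two_mul_sq_le (n k : ℕ) (hk : 2 * k ≤ n) :
    ((2 * n).choose k : ℝ) ^ 2 ≤
      Real.exp ((k : ℝ) ^ 2 / n) * n.choose k * (4 * n).choose k := by
  induction k with
  | zero => simp
  | succ k ih =>
    have hn : (0 : ℝ) < n := by exact_mod_cast (show 0 < n by omega)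
    have hkn : 2 * (k : ℝ) ≤ n := by exact_mod_cast (show 2 * k ≤ n by omega)
    have hk0 : (0 : ℝ) ≤ k := k.cast_nonneg
    have hchoose : ∀ m : ℕ, k ≤ m →
        (m.choose (k + 1) : ℝ) * (k + 1) = m.choose k * ((m : ℝ) - k) := by
      intro m hm
      rw [← Nat.cast_sub hm]
      exact_mod_cast Nat.choose_succ_right_eq m k
    have h1 := hchoose n (by omega)
    have h2 := hchoose (2 * n) (by omega)
    have h4 := hchoose (4 * n) (by omega)
    push_cast at h2 h4
    have hratio : (2 * (n : ℝ) - k) ^ 2 ≤ Real.exp ((k : ℝ) / n) * ((n - k) * (4 * n - k)) := by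
      have hpos : (n : ℝ) ^ 2 ≤ (n - k) * (4 * n - k) := by nlinarith
      have hdiv : (k : ℝ) * n ≤ k / n * ((n - k) * (4 * n - k)) := by
        calc (k : ℝ) * n = k / n * n ^ 2 := by field_simp
          _ ≤ _ := by gcongr
      have hexp := mul_le_mul_of_nonneg_right (Real.add_one_le_exp ((k : ℝ) / n))
        ((sq_nonneg _).trans hpos)
      linarith
    have hexp : Real.exp ((k : ℝ) ^ 2 / n) * Real.exp ((k : ℝ) / n) ≤
        Real.exp (((k : ℝ) + 1) ^ 2 / n) := by
      rw [← Real.exp_add, ← add_div]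
      gcongr
      nlinarith
    have hnk : (0 : ℝ) ≤ (n - k) * (4 * n - k) := mul_nonneg (by linarith) (by linarith)
    push_cast
    refine le_of_mul_le_mul_right ?_ (show (0 : ℝ) < ((k : ℝ) + 1) ^ 2 by positivity)
    calc ((2 * n).choose (k + 1) : ℝ) ^ 2 * ((k : ℝ) + 1) ^ 2
        = ((2 * n).choose k : ℝ) ^ 2 * (2 * n - k) ^ 2 := by rw [← mul_pow, h2, mul_pow]
      _ ≤ (Real.exp ((k : ℝ) ^ 2 / n) * n.choose k * (4 * n).choose k) *
          (Real.exp ((k : ℝ) / n) * ((n - k) * (4 * n - k))) :=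
        mul_le_mul (ih (by omega)) hratio (by positivity) (by positivity)
      _ = (Real.exp ((k : ℝ) ^ 2 / n) * Real.exp ((k : ℝ) / n)) *
          (n.choose k * (4 * n).choose k * ((n - k) * (4 * n - k))) := by ring
      _ ≤ Real.exp (((k : ℝ) + 1) ^ 2 / n) *
          (n.choose k * (4 * n).choose k * ((n - k) * (4 * n - k))) := by gcongr
      _ = Real.exp (((k : ℝ) + 1) ^ 2 / n) *
          ((n.choose k * ((n : ℝ) - k)) * ((4 * n).choose k * (4 * n - k))) := by ring
      _ = _ := by rw [← h1, ← h4]; ring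

theorem stmt_10 (d : ℕ) (hd : 1 ≤ d) (R : ℕ) (u : (Fin d → ℤ) → ℝ)
    (hu : ∀ x : Fin d → ℤ, (∑ i, |x i|) ≤ 4 * (R : ℤ) - 1 → latticeLap d u x = 0)
    (ε : ℝ) (hε0 : 0 ≤ ε) (hε1 : ε ≤ 0.5) :
    ∀ n : ℕ, 16 < n → n ≤ R →
      growthQ d u (2 * n) ≤
        Real.sqrt (Real.exp ((n : ℝ) ^ (-(2 * ε))) * growthQ d u n * growthQ d u (4 * n))
          + (2 : ℝ) ^ (-((n : ℝ) ^ ((0.5 : ℝ) - ε))) * growthQ d u (4 * n) := by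
  intro n hn hnR
  have hn0 : (0 : ℝ) < n := by exact_mod_cast (show 0 < n by omega)
  have hn1 : (1 : ℝ) ≤ n := by exact_mod_cast (show 1 ≤ n by omega)
  have hn16 : (16 : ℝ) < n := by exact_mod_cast hn
  set a : ℕ → ℝ := fun k => (latticeLapLin d ^ k) (fun y => (u y) ^ 2) 0
  have ha : ∀ k ∈ Finset.range (4 * n + 1), 0 ≤ a k := by
    intro k hk
    rw [Finset.mem_range] at hk
    exact latticeLapLin_pow_sq_nonneg d hd k fun y hy => hu y (by omega)
  have hQ : ∀ m, m ≤ 4 * n →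
      growthQ d u m = ∑ k ∈ Finset.range (4 * n + 1), (m.choose k : ℝ) * a k :=
    fun m hm => growthQ_eq_sum d u hm
  set t : ℝ := (n : ℝ) ^ ((0.5 : ℝ) - ε)
  have ht0 : 0 ≤ t := by positivity
  have ht_sq : t ^ 2 = n * (n : ℝ) ^ (-(2 * ε)) := by
    rw [← Real.rpow_natCast, ← Real.rpow_mul hn0.le]
    nth_rewrite 2 [← Real.rpow_one (n : ℝ)]
    rw [← Real.rpow_add hn0]
    congr 1
    push_cast
    ring
  have ht_le : t ^ 2 ≤ n := by
    rw [ht_sq]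
    exact mul_le_of_le_one_right hn0.le (Real.rpow_le_one_of_one_le_of_nonpos hn1 (by linarith))
  rw [hQ n (by omega), hQ (2 * n) (by omega), hQ (4 * n) le_rfl]
  set E := Real.exp ((n : ℝ) ^ (-(2 * ε)))
  have hE : 0 < E := Real.exp_pos _
  set I := Finset.range (4 * n + 1)
  have hmem : ∀ {p : ℕ → Prop} [DecidablePred p], ∀ k ∈ I.filter p, k ∈ I ∧ p k :=
    fun k hk => Finset.mem_filter.1 hk
  have hsub : ∀ (m : ℕ), ∀ (p : ℕ → Prop) [DecidablePred p],
      ∑ k ∈ I.filter p, (m.choose k : ℝ) * a k ≤ ∑ k ∈ I, (m.choose k : ℝ) * a k := by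
    intro m p _
    exact Finset.sum_le_sum_of_subset_of_nonneg (Finset.filter_subset _ _)
      fun k hk _ => mul_nonneg (Nat.cast_nonneg _) (ha k hk)
  have hnonneg : ∀ (m : ℕ), ∀ k ∈ I, 0 ≤ (m.choose k : ℝ) * a k :=
    fun m k hk => mul_nonneg (Nat.cast_nonneg _) (ha k hk)
  rw [← Finset.sum_filter_add_sum_filter_not I (fun k : ℕ => (k : ℝ) < t)]
  refine add_le_add ?_ ?_
  · refine Real.le_sqrt_of_sq_le ?_
    have hcs : (∑ k ∈ I.filter (fun k : ℕ => (k : ℝ) < t), ((2 * n).choose k : ℝ) * a k) ^ 2 ≤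
        (∑ k ∈ I.filter (fun k : ℕ => (k : ℝ) < t), E * ((n.choose k : ℝ) * a k)) *
          ∑ k ∈ I.filter (fun k : ℕ => (k : ℝ) < t), ((4 * n).choose k : ℝ) * a k := by
      refine Finset.sum_sq_le_sum_mul_sum_of_sq_le_mul _
        (fun k hk => mul_nonneg hE.le (hnonneg n k (hmem k hk).1))
        (fun k hk => hnonneg (4 * n) k (hmem k hk).1) fun k hk => ?_
      have hkt : (k : ℝ) < t := (hmem k hk).2
      have hk_sq : (k : ℝ) ^ 2 ≤ t ^ 2 := by gcongr
      have hk2 : 2 * k ≤ n := by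
        have : 2 * (k : ℝ) ≤ n := by nlinarith
        exact_mod_cast this
      have hexp : Real.exp ((k : ℝ) ^ 2 / n) ≤ E := by
        refine Real.exp_le_exp.2 ?_
        rw [div_le_iff₀ hn0, mul_comm, ← ht_sq]
        exact hk_sq
      calc (((2 * n).choose k : ℝ) * a k) ^ 2
          = ((2 * n).choose k : ℝ) ^ 2 * a k ^ 2 := mul_pow _ _ _
        _ ≤ (E * n.choose k * (4 * n).choose k) * a k ^ 2 := by
          gcongr
          exact (choose_two_mul_sq_le n k hk2).trans (by gcongr)
        _ = _ := by ring
    refine hcs.trans ?_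
    rw [← Finset.mul_sum]
    exact mul_le_mul (mul_le_mul_of_nonneg_left (hsub n _) hE.le) (hsub (4 * n) _)
      (Finset.sum_nonneg fun k hk => hnonneg _ k (hmem k hk).1)
      (mul_nonneg hE.le (Finset.sum_nonneg (hnonneg n)))
  · refine le_trans ?_ (mul_le_mul_of_nonneg_left
      (hsub (4 * n) fun k => ¬ (k : ℝ) < t) (by positivity))
    rw [Finset.mul_sum]
    refine Finset.sum_le_sum fun k hk => ?_
    rw [← mul_assoc]
    refine mul_le_mul_of_nonneg_right ?_ (ha k (hmem k hk).1)
    have hpow : (2 : ℝ) ^ t ≤ 2 ^ k := by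
      rw [← Real.rpow_natCast]
      exact Real.rpow_le_rpow_of_exponent_le one_le_two (not_lt.1 (hmem k hk).2)
    have hchoose : ((2 * n).choose k : ℝ) * 2 ^ k ≤ (4 * n).choose k := by
      have := choose_mul_two_pow_le (2 * n) k
      rw [← mul_assoc] at this
      exact_mod_cast this
    rw [Real.rpow_neg zero_le_two, inv_mul_eq_div, le_div_iff₀ (by positivity)]
    exact (mul_le_mul_of_nonneg_left hpow (Nat.cast_nonneg _)).trans hchoose
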